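/- For any string T of length N, the sum of the sizes (numbers of blocks) of all maximal block palindromes of T satisfies ‖MBP(T)‖ ≤ N(2N−1). -/

import Mathlib

variable {α : Type*}

/-- `B` is a border of `S`: a nonempty proper prefix of `S` that is also a suffix of `S`. -/
def IsBorder (B S : List α) : Prop :=
  B ≠ [] ∧ B.length < S.length ∧ B <+: S ∧ B <:+ S

/-- `S` is unbordered: it has no border. -/
def Unbordered (S : List α) : Prop := ∀ B, ¬ IsBorder B S

/-- `B` is the shortest border of `S`. -/
def ShortestBorder (B S : List α) : Prop :=
  IsBorder B S ∧ ∀ B', IsBorder B' S → B.length ≤ B'.length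

/-- `L` is a block palindrome factorization of `T`: a list of nonempty blocks whose
concatenation is `T` and which is equal to its own reversal. -/
def BPFact (T : List α) (L : List (List α)) : Prop :=
  (∀ f ∈ L, f ≠ []) ∧ L.flatten = T ∧ L.reverse = L

/-- `L` is the largest block palindrome (factorization) of `T`: a block palindrome
factorization of `T` with the maximum possible number of blocks. -/
def LargestBPF (T : List α) (L : List (List α)) : Prop :=
  BPFact T L ∧ ∀ K, BPFact T K → K.length ≤ L.length

/-- The substring `T[b..e)` in 0-based half-open coordinates. -/
def Substr (T : List α) (b e : ℕ) : List α := (T.drop b).take (e - b)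

/-- `L ∈ F_T(c, d)`, where the (possibly empty) center block occupies the interval
`[p, q)` of `T` in 0-based half-open coordinates (in the paper's notation,
`p = c - d` and `q = c + d - 1`, so the center block is `T[c-d+1 .. c+d-1]`):
`L` is a largest block palindrome of the substring of `T` occupying `[p - k, q + k)`,
where `k = |f_1 ⋯ f_n|` is the total length of the blocks to the right of the
center block, and the center block of `L` is `T[p..q)`. -/
def MemF (T : List α) (p q : ℕ) (L : List (List α)) : Prop :=
  p ≤ q ∧ q ≤ T.length ∧ L ≠ [] ∧
  ∃ k, k ≤ p ∧ q + k ≤ T.length ∧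
    LargestBPF (Substr T (p - k) (q + k)) L ∧
    k = ((L.drop ((L.length + 1) / 2)).flatten).length ∧
    ((p = q ∧ Even L.length) ∨
     (p < q ∧ Odd L.length ∧ L[L.length / 2]? = some (Substr T p q)))

/-- A maximal block palindrome of `T` with center block occupying `[p, q)`:
an element of `F_T(c, d)` of maximal total length. -/
def MaximalBP (T : List α) (p q : ℕ) (L : List (List α)) : Prop :=
  MemF T p q L ∧ ∀ K, MemF T p q K → K.flatten.length ≤ L.flatten.length

theorem bpf_two_of_border : ∀ (n : ℕ) (B S : List α), B.length ≤ n → IsBorder B S →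
    ∃ K, BPFact S K ∧ 2 ≤ K.length := by
  intro n
  induction n with
  | zero =>
    intro B S h hB
    exact absurd (List.length_eq_zero_iff.mp (Nat.le_zero.mp h)) hB.1
  | succ n ih =>
    intro B S h hB
    obtain ⟨h0, hlt, ⟨C, hC⟩, ⟨D, hD⟩⟩ := hB
    have hBpos : 0 < B.length := List.length_pos_iff.mpr h0
    have hlC : B.length + C.length = S.length := by rw [← hC]; simp
    have hlD : D.length + B.length = S.length := by rw [← hD]; simp
    have hEq : D ++ B = B ++ C := by rw [hC, hD]
    rcases Nat.lt_or_ge D.length B.length with hDB | hDB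
    · obtain ⟨E, hE⟩ : D <+: B := by
        apply List.prefix_of_prefix_length_le (l₃ := S) ⟨B, hD⟩ ⟨C, hC⟩ hDB.le
      have hEC : B = E ++ C := by
        have : D ++ B = D ++ (E ++ C) := by rw [hEq, ← List.append_assoc, hE]
        exact List.append_cancel_left this
      have hlE : D.length + E.length = B.length := by rw [← hE]; simp
      have hEne : E ≠ [] := by
        rintro rfl
        simp at hlE; omega
      apply ih E S (by omega)
      refine ⟨hEne, by omega, ?_, ?_⟩
      · exact List.IsPrefix.trans ⟨C, hEC.symm⟩ ⟨C, hC⟩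
      · exact List.IsSuffix.trans ⟨D, hE⟩ ⟨D, hD⟩
    · obtain ⟨E, hE⟩ : B <+: D := by
        apply List.prefix_of_prefix_length_le (l₃ := S) ⟨C, hC⟩ ⟨B, hD⟩ hDB
      by_cases hEe : E = []
      · refine ⟨[B, B], ⟨?_, ?_, ?_⟩, by simp⟩
        · simp [h0]
        · subst hEe; simp at hE; subst hE; simpa using hD
        · simp
      · refine ⟨[B, E, B], ⟨?_, ?_, ?_⟩, by simp⟩
        · simp [h0, hEe]
        · rw [← hD, ← hE]; simp
        · simp

theorem bpfact_wrap {f S : List α} {K : List (List α)} (hf : f ≠ []) (h : BPFact S K) :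
    BPFact (f ++ S ++ f) (f :: (K ++ [f])) := by
  obtain ⟨h1, h2, h3⟩ := h
  refine ⟨?_, ?_, ?_⟩
  · intro g hg
    simp at hg
    rcases hg with rfl | hg | rfl
    · exact hf
    · exact h1 g hg
    · exact hf
  · simp [h2]
  · simp [h3]

theorem largest_inner {f S : List α} {M : List (List α)}
    (h : LargestBPF S (f :: (M ++ [f]))) : LargestBPF M.flatten M := by
  obtain ⟨⟨h1, h2, h3⟩, h4⟩ := h
  refine ⟨⟨fun g hg => h1 g (by simp [hg]), rfl, by simpa using h3⟩, ?_⟩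
  intro K hK
  have := bpfact_wrap (h1 f (by simp)) hK
  have e : f ++ M.flatten ++ f = S := by rw [← h2]; simp
  rw [e] at this
  simpa using h4 _ this

theorem block_unbordered {f S : List α} {M : List (List α)}
    (h : LargestBPF S (f :: (M ++ [f]))) : Unbordered f := by
  intro B hB
  obtain ⟨K, ⟨k1, k2, k3⟩, hK⟩ := bpf_two_of_border _ B f le_rfl hB
  obtain ⟨⟨h1, h2, h3⟩, h4⟩ := h
  have hM : M.reverse = M := by simpa using h3
  have : BPFact S (K ++ (M ++ K)) := by
    refine ⟨?_, ?_, ?_⟩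
    · intro g hg
      simp at hg
      rcases hg with hg | hg | hg
      · exact k1 g hg
      · exact h1 g (by simp [hg])
      · exact k1 g hg
    · rw [← h2]; simp [k2]
    · simp [k3, hM]
  have := h4 _ this
  simp at this
  omega

theorem len_le_of_largest {f g S : List α} {M M' : List (List α)}
    (h : LargestBPF S (f :: (M ++ [f]))) (h' : LargestBPF S (g :: (M' ++ [g]))) :
    g.length ≤ f.length := by
  by_contra hc
  push Not at hc
  have e : f ++ M.flatten ++ f = S := by rw [← h.1.2.1]; simp
  have e' : g ++ M'.flatten ++ g = S := by rw [← h'.1.2.1]; simp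
  refine block_unbordered h' f ⟨h.1.1 f (by simp), hc, ?_, ?_⟩
  · exact List.prefix_of_prefix_length_le (l₃ := S) ⟨M.flatten ++ f, by simpa using e⟩
      ⟨M'.flatten ++ g, by simpa using e'⟩ hc.le
  · exact List.suffix_of_suffix_length_le (l₃ := S) ⟨_, e⟩ ⟨_, e'⟩ hc.le

theorem largest_unique {L : List (List α)} (hp : L.Palindrome) :
    ∀ (S : List α) (L' : List (List α)), LargestBPF S L → LargestBPF S L' → L = L' := by
  induction hp with
  | nil =>
    intro S L' h h'
    have := h.2 _ h'.1
    simp at this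
    exact this.symm
  | singleton x =>
    intro S L' h h'
    have h1 := h.2 _ h'.1
    have h2 := h'.2 _ h.1
    obtain ⟨y, rfl⟩ := List.length_eq_one_iff.mp (le_antisymm h1 h2)
    have a := h.1.2.1
    have b := h'.1.2.1
    simp at a b
    rw [a, b]
  | @cons_concat f M hM ih =>
    intro S L' h h'
    have h1 := h.2 _ h'.1
    have h2 := h'.2 _ h.1
    have hp' := List.Palindrome.of_reverse_eq h'.1.2.2
    cases hp' with
    | nil => simp at h2
    | singleton y => simp at h2
    | @cons_concat g M' hM' =>
      have hl := le_antisymm (len_le_of_largest h' h) (len_le_of_largest h h')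
      have e : f ++ (M.flatten ++ f) = S := by rw [← h.1.2.1]; simp
      have e' : g ++ (M'.flatten ++ g) = S := by rw [← h'.1.2.1]; simp
      obtain ⟨rfl, e2⟩ := List.append_inj (e.trans e'.symm) hl
      have e3 := List.append_cancel_right e2
      have i1 := largest_inner h
      have i2 := largest_inner h'
      rw [← e3] at i2
      rw [ih _ M' i1 i2]

def armLen (L : List (List α)) : ℕ := ((L.drop ((L.length + 1) / 2)).flatten).length

theorem armLen_wrap (f : List α) (M : List (List α)) :
    armLen (f :: (M ++ [f])) = armLen M + f.length := by
  unfold armLen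
  have : ((f :: (M ++ [f])).length + 1) / 2 = (M.length + 1) / 2 + 1 := by simp; omega
  rw [this, List.drop_succ_cons, List.drop_append_of_le_length]
  · simp
  · cases M <;> simp <;> omega

/-- `M` is the largest block palindrome of `T[b..e)`, with center `[p,q)`. -/
def CenterRel (T : List α) (p q : ℕ) (M : List (List α)) (b e : ℕ) : Prop :=
  LargestBPF (Substr T b e) M ∧ b + armLen M = p ∧ q + armLen M = e ∧ e ≤ T.length ∧ b ≤ e

theorem rel_of_memF {T : List α} {p q : ℕ} {L : List (List α)} (h : MemF T p q L) :
    ∃ b e, CenterRel T p q L b e := by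
  obtain ⟨h1, h2, h3, k, h4, h5, h6, h7, h8⟩ := h
  change k = armLen L at h7
  exact ⟨p - k, q + k, h6, by omega, by omega, h5, by omega⟩

theorem substr_length (T : List α) (b e : ℕ) (h : e ≤ T.length) :
    (Substr T b e).length = e - b := by
  simp [Substr]; omega

theorem rel_peel {T : List α} {p q b e : ℕ} {f : List α} {M : List (List α)}
    (h : CenterRel T p q (f :: (M ++ [f])) b e) : CenterRel T p q M (b + f.length) (e - f.length) := by
  obtain ⟨h1, h2, h3, h4, h5⟩ := h
  rw [armLen_wrap] at h2 h3
  have hfl : f ++ (M.flatten ++ f) = Substr T b e := by rw [← h1.1.2.1]; simp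
  have hlen := congrArg List.length hfl
  rw [substr_length T b e h4] at hlen
  simp at hlen
  refine ⟨?_, by omega, by omega, by omega, by omega⟩
  have : Substr T (b + f.length) (e - f.length) = M.flatten := by
    have e1 : Substr T (b + f.length) (e - f.length)
        = ((Substr T b e).drop f.length).take M.flatten.length := by
      simp only [Substr, List.drop_take, List.drop_drop, List.take_take]
      congr 1
      simp
      omega
    rw [e1, ← hfl]
    simp
  rw [this]
  exact largest_inner h1

theorem rel_unique {T : List α} {p q p' q' b e : ℕ} {M M' : List (List α)}
    (h : CenterRel T p q M b e) (h' : CenterRel T p' q' M' b e) : p = p' ∧ q = q' ∧ M = M' := by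
  have := largest_unique (List.Palindrome.of_reverse_eq h.1.1.2.2) _ _ h.1 h'.1
  subst this
  obtain ⟨-, h2, h3, -⟩ := h
  obtain ⟨-, h2', h3', -⟩ := h'
  refine ⟨by omega, by omega, rfl⟩

theorem rel_lt {T : List α} {p q b e : ℕ} {M : List (List α)}
    (h : CenterRel T p q M b e) (hM : M ≠ []) : b < e := by
  obtain ⟨h1, h2, h3, h4, h5⟩ := h
  have hl := substr_length T b e h4
  rw [← h1.1.2.1] at hl
  cases M with
  | nil => exact absurd rfl hM
  | cons f M =>
    have := List.length_pos_iff.mpr (h1.1.1 f (by simp))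
    simp at hl
    omega

theorem rel_chain {T : List α} {p q b e : ℕ} {L : List (List α)}
    (h : CenterRel T p q L b e) (i : ℕ) (hi : i < (L.length + 1) / 2) :
    ∃ b' e' M, CenterRel T p q M b' e' ∧ M.length + 2 * i = L.length := by
  induction i with
  | zero => exact ⟨b, e, L, h, by simp⟩
  | succ i ih =>
    obtain ⟨b', e', M, hM, hl⟩ := ih (by omega)
    have hp := List.Palindrome.of_reverse_eq hM.1.1.2.2
    cases hp with
    | nil => simp at hl; omega
    | singleton y => simp at hl; omega
    | @cons_concat g M' hM' =>
      refine ⟨_, _, M', rel_peel hM, ?_⟩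
      simp at hl; omega

theorem len_le_flatten (L : List (List α)) (h : ∀ f ∈ L, f ≠ []) :
    L.length ≤ L.flatten.length := by
  induction L with
  | nil => simp
  | cons f L ih =>
    have := List.length_pos_iff.mpr (h f (by simp))
    have := ih (fun g hg => h g (by simp [hg]))
    simp at this ⊢
    omega

theorem memF_length_le {T : List α} {p q : ℕ} {L : List (List α)} (h : MemF T p q L) :
    p ≤ q ∧ q ≤ T.length ∧ L.length ≤ q - p + 2 * min p (T.length - q) := by
  obtain ⟨h1, h2, h3, k, h4, h5, h6, h7, h8⟩ := h
  have := len_le_flatten L h6.1.1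
  rw [h6.1.2.1, substr_length _ _ _ h5] at this
  refine ⟨h1, h2, ?_⟩
  omega

open Classical in
/-- Intervals (stored as end, start) whose largest block palindrome has center `[p,q)`. -/
noncomputable def chainSet (T : List α) (x : ℕ × ℕ) : Finset (Σ _ : ℕ, ℕ) :=
  ((Finset.range (T.length + 1)).sigma (fun e => Finset.range e)).filter
    (fun y => ∃ M, CenterRel T x.1 x.2 M y.2 y.1)

theorem chain_card {T : List α} {p q : ℕ} {L : List (List α)} (h : MemF T p q L) :
    (L.length + 1) / 2 ≤ (chainSet T (p, q)).card := by
  classical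
  obtain ⟨b, e, hR⟩ := rel_of_memF h
  choose! B E M hM using fun i hi => rel_chain hR i hi
  rw [← Finset.card_range ((L.length + 1) / 2)]
  apply Finset.card_le_card_of_injOn (fun i => (⟨E i, B i⟩ : Σ _ : ℕ, ℕ))
  · intro i hi
    have hi' : i < (L.length + 1) / 2 := by simpa using hi
    obtain ⟨r, hl⟩ := hM i hi'
    have hne : M i ≠ [] := by
      intro h0
      rw [h0] at hl
      simp at hl
      omega
    have := rel_lt r hne
    have := r.2.2.2.1
    simp only [chainSet, Finset.coe_filter, Set.mem_setOf_eq, Finset.mem_sigma, Finset.mem_range]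
    exact ⟨⟨by omega, by omega⟩, M i, r⟩
  · intro i hi j hj hij
    have hi' : i < (L.length + 1) / 2 := by simpa using hi
    have hj' : j < (L.length + 1) / 2 := by simpa using hj
    simp only [Sigma.mk.injEq, heq_eq_eq] at hij
    obtain ⟨r, hl⟩ := hM i hi'
    obtain ⟨r', hl'⟩ := hM j hj'
    rw [hij.1, hij.2] at r
    have := (rel_unique r r').2.2
    rw [this] at hl
    omega

theorem chain_sum (T : List α) (s : Finset (ℕ × ℕ)) :
    (∑ x ∈ s, (chainSet T x).card) * 2 ≤ (T.length + 1) * T.length := by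
  classical
  rw [← Finset.card_biUnion]
  · have h1 : (s.biUnion (chainSet T)).card ≤
        ((Finset.range (T.length + 1)).sigma (fun e => Finset.range e)).card := by
      apply Finset.card_le_card
      intro y hy
      obtain ⟨x, -, hx⟩ := Finset.mem_biUnion.mp hy
      exact (Finset.mem_filter.mp hx).1
    have h2 := Finset.sum_range_id_mul_two (T.length + 1)
    simp only [Finset.card_sigma, Finset.card_range] at h1
    simp only [Nat.add_sub_cancel] at h2
    rw [← h2]
    exact Nat.mul_le_mul_right 2 h1
  · intro x _ x' _ hne
    rw [Function.onFun, Finset.disjoint_left]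
    intro y hy hy'
    obtain ⟨M, hM⟩ := (Finset.mem_filter.mp hy).2
    obtain ⟨M', hM'⟩ := (Finset.mem_filter.mp hy').2
    have := rel_unique hM hM'
    exact hne (Prod.ext this.1 this.2.1)

/-- For any string `T` of length `N`, the sum of the sizes (numbers of blocks) of all
maximal block palindromes of `T` satisfies `‖MBP(T)‖ ≤ N * (2N - 1)`.  The function `F`
picks, for each center-block interval `[p, q)` (0-based half-open coordinates), the
maximal block palindrome of `F_T(c, d)` if one exists, and `[]` (contributing `0`)
otherwise. -/
theorem sum_sizes_of_maximal_BPs_le (T : List α)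
    (F : ℕ → ℕ → List (List α))
    (hF : ∀ p q, (∃ L, MemF T p q L) → MaximalBP T p q (F p q))
    (hF0 : ∀ p q, ¬ (∃ L, MemF T p q L) → F p q = []) :
    ∑ p ∈ Finset.range (T.length + 1), ∑ q ∈ Finset.range (T.length + 1),
      (F p q).length ≤ T.length * (2 * T.length - 1) := by
  have hlen : ∀ p q, (F p q).length ≤ 2 * (chainSet T (p, q)).card := by
    intro p q
    by_cases h : ∃ L, MemF T p q L
    · have := chain_card (hF p q h).1
      omega
    · simp [hF0 p q h]
  have hsmall : ∀ p q, (F p q).length = 0 ∨ (p ≤ q ∧ q ≤ T.length ∧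
      (F p q).length ≤ q - p + 2 * min p (T.length - q)) := by
    intro p q
    by_cases h : ∃ L, MemF T p q L
    · exact Or.inr (memF_length_le (hF p q h).1)
    · simp [hF0 p q h]
  rcases Nat.lt_or_ge T.length 2 with hT | hT
  · have a := hsmall 0 0
    have b := hsmall 0 1
    have c := hsmall 1 0
    have d := hsmall 1 1
    obtain h | h : T.length = 0 ∨ T.length = 1 := by omega
    · rw [h] at a ⊢
      simp only [Nat.zero_add, Finset.sum_range_one]
      omega
    · rw [h] at a b c d ⊢
      simp only [Finset.sum_range_succ, Finset.sum_range_zero]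
      omega
  · rw [← Finset.sum_product']
    have h1 := chain_sum T (Finset.range (T.length + 1) ×ˢ Finset.range (T.length + 1))
    have h2 : ∑ x ∈ Finset.range (T.length + 1) ×ˢ Finset.range (T.length + 1),
        (F x.1 x.2).length ≤
        ∑ x ∈ Finset.range (T.length + 1) ×ˢ Finset.range (T.length + 1),
          2 * (chainSet T x).card := Finset.sum_le_sum (fun x _ => hlen x.1 x.2)
    rw [← Finset.mul_sum, mul_comm] at h2
    refine (h2.trans h1).trans ?_
    rw [mul_comm]
    exact Nat.mul_le_mul_left _ (by omega)
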